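/- The function P: KL → 2ℤ, defined on a knot-like complex C with standard complex representative C(a_1,…,a_n) by P(C) = −2 Σ_{j>0} j φ_j(C) + Σ_{i=1}^n sgn(a_i), is a surjective group homomorphism from the local equivalence group KL onto 2ℤ. -/

import Mathlib

/-!
Common setup: the ring `R = 𝔽₂[U,V]/(UV = 0)`, bigraded free finitely generated chain
complexes over `R` ("pre-complexes"), knot-like complexes, local maps and local
equivalence, standard and semistandard complexes, short maps, the `Z^!` order,
the invariants `a_i`, `φ_j`, `P`, shift maps, tensor products, duals, and direct sums.
-/

set_option synthInstance.maxHeartbeats 1000000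
set_option maxHeartbeats 1000000

noncomputable section

/-- The polynomial ring `𝔽₂[U,V]`. -/
abbrev PolyUV : Type := MvPolynomial (Fin 2) (ZMod 2)

/-- The ideal `(U·V)`. -/
def IUV : Ideal PolyUV := Ideal.span {(MvPolynomial.X 0 * MvPolynomial.X 1 : PolyUV)}

/-- The ring `R = 𝔽₂[U,V]/(UV = 0)`. -/
abbrev RUV : Type := PolyUV ⧸ IUV

instance : CommRing RUV := Ideal.Quotient.commRing IUV

/-- The image of `U` in `R`. -/
def Uv : RUV := Ideal.Quotient.mk IUV (MvPolynomial.X 0)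

/-- The image of `V` in `R`. -/
def Vv : RUV := Ideal.Quotient.mk IUV (MvPolynomial.X 1)

/-- `r ∈ R` is homogeneous of bidegree `(p, q)` for the bigrading with
`gr(U) = (-2, 0)`, `gr(V) = (0, -2)`, `gr(1) = (0, 0)` (coefficients in `𝔽₂`). -/
def IsHomog (r : RUV) (p q : ℤ) : Prop :=
  r = 0 ∨ (∃ a : ℕ, r = Uv ^ a ∧ p = -(2 * (a : ℤ)) ∧ q = 0) ∨
    (∃ b : ℕ, r = Vv ^ b ∧ p = 0 ∧ q = -(2 * (b : ℤ)))

/-- A finitely generated free bigraded module over `R` with a distinguished basis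
indexed by `Fin n`, together with a bigrading `gr` on the basis and a matrix `dm`
recording a prospective differential: `dm i j` is the coefficient of the `j`-th basis
vector in the differential of the `i`-th basis vector. -/
structure PreCx where
  n : ℕ
  gr : Fin n → ℤ × ℤ
  dm : Fin n → Fin n → RUV

/-- The underlying free `R`-module of a pre-complex. -/
abbrev Msub (C : PreCx) : Type := Fin C.n →₀ RUV

/-- The differential of a pre-complex, as an `R`-linear map. -/
def dmap (C : PreCx) : Msub C →ₗ[RUV] Msub C :=
  Finsupp.linearCombination RUV fun i => ∑ j, Finsupp.single j (C.dm i j)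

/-- The submodule `U·C ⊆ C`; `C/U` is the quotient by this submodule. -/
def uSub (C : PreCx) : Submodule RUV (Msub C) :=
  LinearMap.range (LinearMap.lsmul RUV (Msub C) Uv)

/-- The submodule `V·C ⊆ C`; `C/V` is the quotient by this submodule. -/
def vSub (C : PreCx) : Submodule RUV (Msub C) :=
  LinearMap.range (LinearMap.lsmul RUV (Msub C) Vv)

/-- Chains which die in the homology of `C/U`: the preimage in `C` of the boundaries of
the induced differential on `C/U`. -/
def bdryU (C : PreCx) : Submodule RUV (Msub C) := uSub C ⊔ LinearMap.range (dmap C)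

/-- Chains which die in the homology of `C/V`. -/
def bdryV (C : PreCx) : Submodule RUV (Msub C) := vSub C ⊔ LinearMap.range (dmap C)

/-- A chain `x ∈ C` is homogeneous of bidegree `(p, q)`. -/
def ChainHomog (C : PreCx) (x : Msub C) (p q : ℤ) : Prop :=
  ∀ j, IsHomog (x j) (p - (C.gr j).1) (q - (C.gr j).2)

/-- `x` is a `V`-tower class generator: its class in `H_*(C/U)` is a `V`-nontorsion cycle
whose image generates `H_*(C/U)/(V-torsion)` (equivalently, it is maximally `V`-graded
among `V`-nontorsion classes). -/
def IsVTowerGen (C : PreCx) (x : Msub C) : Prop :=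
  dmap C x ∈ uSub C ∧ (∀ k : ℕ, Vv ^ k • x ∉ bdryU C) ∧
    ∀ z : Msub C, dmap C z ∈ uSub C →
      ∃ (r : RUV) (k : ℕ), Vv ^ k • (z - r • x) ∈ bdryU C

/-- `x` is a `U`-tower class generator: its class in `H_*(C/V)` is a `U`-nontorsion cycle
whose image generates `H_*(C/V)/(U-torsion)`. -/
def IsUTowerGen (C : PreCx) (x : Msub C) : Prop :=
  dmap C x ∈ vSub C ∧ (∀ k : ℕ, Uv ^ k • x ∉ bdryV C) ∧
    ∀ z : Msub C, dmap C z ∈ vSub C →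
      ∃ (r : RUV) (k : ℕ), Uv ^ k • (z - r • x) ∈ bdryV C

/-- `C` is a chain complex over `R` whose differential has degree `(-1, -1)`. -/
def IsCplx (C : PreCx) : Prop :=
  (∀ x, dmap C (dmap C x) = 0) ∧
    ∀ i j, IsHomog (C.dm i j) ((C.gr i).1 - 1 - (C.gr j).1) ((C.gr i).2 - 1 - (C.gr j).2)

/-- A knot-like complex: a free, finitely generated, bigraded chain complex over `R`
whose differential has degree `(-1,-1)`, such that `H_*(C/U)/(V`-torsion`) ≅ 𝔽₂[V]` with
all `V`-nontorsion elements of `H_*(C/U)` in `U`-grading `0`, and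
`H_*(C/V)/(U`-torsion`) ≅ 𝔽₂[U]` with all `U`-nontorsion elements of `H_*(C/V)` in
`V`-grading `0`. -/
structure IsKnotLike (C : PreCx) : Prop where
  dsq : ∀ x, dmap C (dmap C x) = 0
  dhomog : ∀ i j, IsHomog (C.dm i j)
    ((C.gr i).1 - 1 - (C.gr j).1) ((C.gr i).2 - 1 - (C.gr j).2)
  vTowerExists : ∃ x, IsVTowerGen C x
  vTowerGr : ∀ x p q, ChainHomog C x p q → dmap C x ∈ uSub C →
    (∀ k : ℕ, Vv ^ k • x ∉ bdryU C) → p = 0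
  uTowerExists : ∃ x, IsUTowerGen C x
  uTowerGr : ∀ x p q, ChainHomog C x p q → dmap C x ∈ vSub C →
    (∀ k : ℕ, Uv ^ k • x ∉ bdryV C) → q = 0

/-- A module map `f : C₁ → C₂` is homogeneous of bidegree `(s, t)`. -/
def MapHomogShift (C₁ C₂ : PreCx) (f : Msub C₁ →ₗ[RUV] Msub C₂) (s t : ℤ) : Prop :=
  ∀ i j, IsHomog (f (Finsupp.single i 1) j)
    ((C₁.gr i).1 + s - (C₂.gr j).1) ((C₁.gr i).2 + t - (C₂.gr j).2)

/-- A local map `f : C₁ → C₂`: an absolutely `U`-graded, relatively `V`-graded,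
`R`-equivariant chain map inducing an isomorphism on `H_*(·/U)/(V-torsion)`
(equivalently, taking `V`-tower generators to `V`-tower generators). -/
structure IsLocalMap (C₁ C₂ : PreCx) (f : Msub C₁ →ₗ[RUV] Msub C₂) : Prop where
  chain : ∀ x, f (dmap C₁ x) = dmap C₂ (f x)
  graded : ∃ s : ℤ, MapHomogShift C₁ C₂ f 0 s
  towers : ∀ x, IsVTowerGen C₁ x → IsVTowerGen C₂ (f x)

/-- `C₁ ≤ C₂`: there exists a local map `C₁ → C₂`. -/
def LocalLE (C₁ C₂ : PreCx) : Prop := ∃ f, IsLocalMap C₁ C₂ f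

/-- Local equivalence of complexes: local maps in both directions. -/
def LocalEquiv (C₁ C₂ : PreCx) : Prop := LocalLE C₁ C₂ ∧ LocalLE C₂ C₁

/-- `C` is reduced: `∂ ≡ 0 mod (U, V)`. -/
def Reduced (C : PreCx) : Prop := ∀ i j, C.dm i j ∈ Ideal.span ({Uv, Vv} : Set RUV)

/-! ### Standard complexes -/

/-- The shift in bigrading from `x_k` to `x_{k+1}` in a standard complex, where the
parameter joining them is `b` (`k` is the 0-based index of the parameter, so the
parameter is a `U`-power arrow if `k` is even and a `V`-power arrow if `k` is odd). -/
def stepShift (k : ℕ) (b : ℤ) : ℤ × ℤ :=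
  if k % 2 = 0 then
    if b < 0 then (2 * (b.natAbs : ℤ) - 1, -1) else (1 - 2 * (b.natAbs : ℤ), 1)
  else
    if b < 0 then (-1, 2 * (b.natAbs : ℤ) - 1) else (1, 1 - 2 * (b.natAbs : ℤ))

/-- Bigrading of `x_i` relative to `x_0` in the standard complex with parameters `L`. -/
def grRel (L : List ℤ) (i : ℕ) : ℤ × ℤ :=
  ∑ k ∈ Finset.range i, stepShift k (L.getD k 0)

/-- The bigrading of the standard complex of parameters `L`, normalized so that
`gr_U(x_0) = 0` and `gr_V(x_n) = 0`. -/
def stdGr (L : List ℤ) (i : Fin (L.length + 1)) : ℤ × ℤ :=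
  ((grRel L (i : ℕ)).1, (grRel L (i : ℕ)).2 - (grRel L L.length).2)

/-- The differential matrix of the standard complex of parameters `L = (b_1, …, b_n)`:
for `i` odd (1-based), `∂_U x_{i-1} = U^{|b_i|} x_i` if `b_i < 0` and
`∂_U x_i = U^{b_i} x_{i-1}` if `b_i > 0`; for `i` even the same with `V` in place of `U`;
all other differentials vanish. -/
def stdDm (L : List ℤ) (i j : Fin (L.length + 1)) : RUV :=
  if (j : ℕ) = (i : ℕ) + 1 ∧ L.getD (i : ℕ) 0 < 0 then
    (if (i : ℕ) % 2 = 0 then Uv else Vv) ^ (L.getD (i : ℕ) 0).natAbs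
  else if (i : ℕ) = (j : ℕ) + 1 ∧ 0 < L.getD (j : ℕ) 0 then
    (if (j : ℕ) % 2 = 0 then Uv else Vv) ^ (L.getD (j : ℕ) 0).natAbs
  else 0

/-- The standard complex `C(b_1, …, b_n)` of a list of parameters `L = (b_1, …, b_n)`,
with generators `x_0, …, x_n`.  (For `L = []` this is the trivial complex `R`.) -/
def StdCx (L : List ℤ) : PreCx := ⟨L.length + 1, stdGr L, stdDm L⟩

/-- `L` is a valid parameter sequence for a standard complex: all entries are nonzero
and the length is even (possibly zero). -/
def IsStdSeq (L : List ℤ) : Prop := (∀ b ∈ L, b ≠ 0) ∧ Even L.length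

/-- The trivial standard complex `C(0) = R`. -/
def trivCx : PreCx := StdCx []

/-- The bigrading of the semistandard complex `C'(b_1, …, b_n)` (`n` odd), inherited from
the ambient standard complex `C(b_1, …, b_n, 1)`. -/
def semiGr (L : List ℤ) (i : Fin (L.length + 1)) : ℤ × ℤ :=
  ((grRel L (i : ℕ)).1, (grRel L (i : ℕ)).2 - (grRel L L.length).2 + 1)

/-- The semistandard complex `C'(b_1, …, b_n)` (`n` odd): the subcomplex of
`C(b_1, …, b_n, 1)` generated by `x_0, …, x_n`. -/
def SemiStdCx (L : List ℤ) : PreCx := ⟨L.length + 1, semiGr L, stdDm L⟩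

/-! ### Tensor products, duals, direct sums -/

/-- The tensor product (over `R`) of two pre-complexes, with basis `x_i ⊗ y_j` and
differential `∂(x ⊗ y) = ∂x ⊗ y + x ⊗ ∂y` (signs are irrelevant in characteristic 2). -/
def tensorCx (C₁ C₂ : PreCx) : PreCx where
  n := C₁.n * C₂.n
  gr := fun p => C₁.gr (finProdFinEquiv.symm p).1 + C₂.gr (finProdFinEquiv.symm p).2
  dm := fun p q =>
    (if (finProdFinEquiv.symm p).2 = (finProdFinEquiv.symm q).2 then
      C₁.dm (finProdFinEquiv.symm p).1 (finProdFinEquiv.symm q).1 else 0) +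
    (if (finProdFinEquiv.symm p).1 = (finProdFinEquiv.symm q).1 then
      C₂.dm (finProdFinEquiv.symm p).2 (finProdFinEquiv.symm q).2 else 0)

/-- The dual complex `C^∨ = Hom_R(C, R)`, described on the dual basis: the gradings are
negated and the differential matrix is transposed. -/
def dualCx (C : PreCx) : PreCx := ⟨C.n, fun i => -C.gr i, fun i j => C.dm j i⟩

/-- The direct sum of two pre-complexes. -/
def sumCx (C₁ C₂ : PreCx) : PreCx where
  n := C₁.n + C₂.n
  gr := fun p => Sum.elim C₁.gr C₂.gr (finSumFinEquiv.symm p)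
  dm := fun p q =>
    match finSumFinEquiv.symm p, finSumFinEquiv.symm q with
    | Sum.inl i, Sum.inl k => C₁.dm i k
    | Sum.inr j, Sum.inr l => C₂.dm j l
    | _, _ => 0

/-- A homotopy equivalence of bigraded chain complexes over `R`: chain maps `f, g`
preserving the bigrading, with `g ∘ f ≃ id` and `f ∘ g ≃ id` via `R`-equivariant
homotopies of bidegree `(1, 1)`. -/
def HomotopyEquivCx (C₁ C₂ : PreCx) : Prop :=
  ∃ (f : Msub C₁ →ₗ[RUV] Msub C₂) (g : Msub C₂ →ₗ[RUV] Msub C₁)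
    (H : Msub C₁ →ₗ[RUV] Msub C₁) (K : Msub C₂ →ₗ[RUV] Msub C₂),
    (∀ x, f (dmap C₁ x) = dmap C₂ (f x)) ∧
    (∀ y, g (dmap C₂ y) = dmap C₁ (g y)) ∧
    MapHomogShift C₁ C₂ f 0 0 ∧ MapHomogShift C₂ C₁ g 0 0 ∧
    MapHomogShift C₁ C₁ H 1 1 ∧ MapHomogShift C₂ C₂ K 1 1 ∧
    (∀ x, g (f x) - x = dmap C₁ (H x) + H (dmap C₁ x)) ∧
    (∀ y, f (g y) - y = dmap C₂ (K y) + K (dmap C₂ y))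

/-- An isomorphism of bigraded chain complexes over `R`. -/
def IsBigradedChainIso (C₁ C₂ : PreCx) (f : Msub C₁ →ₗ[RUV] Msub C₂) : Prop :=
  Function.Bijective f ∧ (∀ x, f (dmap C₁ x) = dmap C₂ (f x)) ∧ MapHomogShift C₁ C₂ f 0 0

/-! ### Short maps -/

/-- A short map `f : C(b_1, …, b_n) ⇝ C`: an absolutely `U`-graded, relatively
`V`-graded `R`-module map which is a chain map at `x_1, …, x_{n-1}` and commutes with
the `V`-part of the differential at `x_n` (for reduced `C`, the failure
`∂ f(x_n) - f(∂_V x_n)` is exactly `∂_U f(x_n) ∈ U·C`). -/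
def IsShortMap (L : List ℤ) (C : PreCx) (f : Msub (StdCx L) →ₗ[RUV] Msub C) : Prop :=
  (∃ s : ℤ, MapHomogShift (StdCx L) C f 0 s) ∧
  (∀ i : Fin (L.length + 1), 1 ≤ (i : ℕ) → (i : ℕ) + 1 ≤ L.length →
    f (dmap (StdCx L) (Finsupp.single i 1)) = dmap C (f (Finsupp.single i 1))) ∧
  dmap C (f (Finsupp.single (Fin.last L.length) 1)) -
    f (dmap (StdCx L) (Finsupp.single (Fin.last L.length) 1)) ∈ uSub C

/-- A short local map: a short map sending the `V`-tower generator `x_0` to a `V`-tower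
generator (hence inducing an isomorphism on `H_*(·/U)/(V-torsion)`). -/
def IsShortLocalMap (L : List ℤ) (C : PreCx) (f : Msub (StdCx L) →ₗ[RUV] Msub C) : Prop :=
  IsShortMap L C f ∧ IsVTowerGen C (f (Finsupp.single (0 : Fin (L.length + 1)) 1))

/-- A local map from the semistandard complex `C'(b_1, …, b_n)` to a knot-like complex:
a grading-preserving `R`-equivariant chain map under which the class of `x_0`
generates `H_*(C/U)/(V-torsion)`. -/
def IsSemiLocalMap (L : List ℤ) (C : PreCx) (f : Msub (SemiStdCx L) →ₗ[RUV] Msub C) : Prop :=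
  (∀ x, f (dmap (SemiStdCx L) x) = dmap C (f x)) ∧
  MapHomogShift (SemiStdCx L) C f 0 0 ∧
  IsVTowerGen C (f (Finsupp.single (0 : Fin (L.length + 1)) 1))

/-! ### The order `Z^!` and the numerical invariants -/

/-- The embedding of `Z^!` into `ℚ` realizing the order
`-1 <^! -2 <^! ⋯ <^! 0 <^! ⋯ <^! 2 <^! 1`: send `0 ↦ 0` and `a ↦ 1/a` otherwise. -/
def qval (a : ℤ) : ℚ := if a = 0 then 0 else 1 / (a : ℚ)

/-- The order `≤^!` on `Z^!`. -/
def bangLE (a b : ℤ) : Prop := qval a ≤ qval b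

/-- Pad a finite sequence with trailing zeros. -/
def seqPad (L : List ℤ) (i : ℕ) : ℤ := L.getD i 0

/-- The lexicographic order on finite integer sequences induced by `≤^!`, padding the
shorter sequence with trailing zeros. -/
def bangLexLE (L₁ L₂ : List ℤ) : Prop :=
  (∀ i, seqPad L₁ i = seqPad L₂ i) ∨
    ∃ k, (∀ i < k, seqPad L₁ i = seqPad L₂ i) ∧ qval (seqPad L₁ k) < qval (seqPad L₂ k)

/-- `m` is an upper bound for `S ⊆ Z^!` with respect to `≤^!`. -/
def IsBangUB (S : Set ℤ) (m : ℤ) : Prop := ∀ b ∈ S, qval b ≤ qval m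

/-- `m = sup^! S`, the least upper bound of `S ⊆ Z^!` with respect to `≤^!`. -/
def IsBangLUB (S : Set ℤ) (m : ℤ) : Prop :=
  IsBangUB S m ∧ ∀ m' : ℤ, IsBangUB S m' → qval m ≤ qval m'

/-- Candidate set for the next invariant: given the already-constructed prefix `P`,
those nonzero `b` such that some standard complex `C(P, b, rest) ≤ C`. -/
def candSet (C : PreCx) (P : List ℤ) : Set ℤ :=
  {b | b ≠ 0 ∧ ∃ rest : List ℤ, IsStdSeq (P ++ b :: rest) ∧ LocalLE (StdCx (P ++ b :: rest)) C}

/-- `a` is the sequence of numerical invariants `a_i(C)` (indexed from `0`):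
once a term vanishes all later terms vanish, and otherwise each term is
`sup^!` of the corresponding candidate set. -/
def InvSeq (C : PreCx) (a : ℕ → ℤ) : Prop :=
  ∀ k : ℕ,
    ((∃ i < k, a i = 0) → a k = 0) ∧
    ((∀ i < k, a i ≠ 0) → IsBangLUB (candSet C ((List.range k).map a)) (a k))

/-- The first `n` terms of `a`, with the (all-zero) tail deleted. -/
def truncSeq (a : ℕ → ℤ) (n : ℕ) : List ℤ :=
  ((List.range n).map a).takeWhile (fun b => b != 0)

/-! ### The homomorphisms `φ_j`, `P` and the shifts `sh_m` -/

/-- `φ_j` of a standard complex `C(a_1, …, a_n)`: the signed count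
`#{i odd : a_i = j} − #{i odd : a_i = −j}` (with 1-based odd `i`). -/
def phi (j : ℕ) (L : List ℤ) : ℤ :=
  ∑ i ∈ Finset.range L.length,
    if i % 2 = 0 then
      (if L.getD i 0 = (j : ℤ) then 1 else 0) - (if L.getD i 0 = -(j : ℤ) then 1 else 0)
    else 0

/-- The shift `sh_m` on parameter sequences: entries of absolute value `≥ m` are pushed
one further from zero; entries of absolute value `< m` are fixed. -/
def shSeq (m : ℕ) (L : List ℤ) : List ℤ :=
  L.map fun a => if (m : ℤ) ≤ a then a + 1 else if a ≤ -(m : ℤ) then a - 1 else a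

/-- `P(C) = -2 ∑_{j>0} j φ_j(C) + ∑_i sgn a_i`, computed from the parameter sequence of
the standard representative (the sum over `j` is finite since `φ_j` vanishes for
`j` larger than any `|a_i|`). -/
def Pval (L : List ℤ) : ℤ :=
  -2 * (∑ j ∈ Finset.range ((L.map Int.natAbs).sum + 1), (j : ℤ) * phi j L) +
    (L.map Int.sign).sum

end

noncomputable section KnotLikeTowers

open Polynomial Matrix
open scoped Kronecker

/-! ### Specializations of `R` -/

/-- The specialization `R → 𝔽₂[X]` killing one of `U`, `V` and sending the other to `X`:
`U` survives for `t = 0` and `V` survives for `t = 1`. -/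
def spec (t : Fin 2) : RUV →+* (ZMod 2)[X] :=
  Ideal.Quotient.lift IUV
    (MvPolynomial.aeval (R := ZMod 2) (fun i => if i = t then (X : (ZMod 2)[X]) else 0)).toRingHom
    (by
      have h : IUV ≤ RingHom.ker (MvPolynomial.aeval (R := ZMod 2)
          (fun i => if i = t then (X : (ZMod 2)[X]) else 0)).toRingHom := by
        refine Ideal.span_le.2 ?_
        rintro _ rfl
        fin_cases t <;> simp [RingHom.mem_ker]
      exact fun a ha => h ha)

theorem spec_Uv (t : Fin 2) : spec t Uv = if t = 0 then X else 0 := by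
  simp [spec, Uv, eq_comm]

theorem spec_Vv (t : Fin 2) : spec t Vv = if t = 1 then X else 0 := by
  simp [spec, Vv, eq_comm]

theorem ringHom_ext_RUV {S : Type*} [CommRing S] {f g : RUV →+* S} (hU : f Uv = g Uv)
    (hV : f Vv = g Vv) : f = g := by
  refine Ideal.Quotient.ringHom_ext (MvPolynomial.ringHom_ext (fun r => ?_) (fun i => ?_))
  · exact congrArg (fun φ : ZMod 2 →+* S => φ r) (Subsingleton.elim
      ((f.comp (Ideal.Quotient.mk IUV)).comp MvPolynomial.C)
      ((g.comp (Ideal.Quotient.mk IUV)).comp MvPolynomial.C))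
  · fin_cases i
    · exact hU
    · exact hV

theorem eval_zero_spec (t t' : Fin 2) (r : RUV) : (spec t r).eval 0 = (spec t' r).eval 0 := by
  have h : (evalRingHom 0).comp (spec t) = (evalRingHom 0).comp (spec t') :=
    ringHom_ext_RUV (by simp [spec_Uv, apply_ite (eval (0 : ZMod 2))])
      (by simp [spec_Vv, apply_ite (eval (0 : ZMod 2))])
  exact congrArg (fun f => f r) h

theorem Uv_mul_Vv : Uv * Vv = 0 := by
  rw [Uv, Vv, ← map_mul, Ideal.Quotient.eq_zero_iff_mem]
  exact Ideal.subset_span rfl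

theorem add_self_RUV (r : RUV) : r + r = 0 := by
  have h : ((1 : ZMod 2) + 1) = 0 := rfl
  have h' := congrArg (fun c => (Ideal.Quotient.mk IUV) (MvPolynomial.C c)) h
  simp only [map_add, map_one, map_zero] at h'
  rw [← one_mul r, ← add_mul, h', zero_mul]

/-- The section of `spec 1` sending `X` to `V`. -/
def secV : (ZMod 2)[X] →+* RUV :=
  eval₂RingHom ((Ideal.Quotient.mk IUV).comp MvPolynomial.C) Vv

theorem spec_secV (p : (ZMod 2)[X]) : spec 1 (secV p) = p := by
  have h : (spec 1).comp secV = RingHom.id _ := by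
    refine Polynomial.ringHom_ext (fun r => ?_) (by simp [secV, spec_Vv])
    exact congrArg (fun φ : ZMod 2 →+* (ZMod 2)[X] => φ r)
      (Subsingleton.elim (((spec 1).comp secV).comp C) ((RingHom.id _).comp C))
  exact congrArg (fun f => f p) h

theorem spec_one_eq_zero_iff (r : RUV) : spec 1 r = 0 ↔ ∃ s, r = Uv * s := by
  constructor
  · intro h
    have hq : Ideal.Quotient.mk (Ideal.span {Uv}) =
        ((Ideal.Quotient.mk (Ideal.span {Uv})).comp secV).comp (spec 1) :=
      ringHom_ext_RUV
        (by simp [spec_Uv])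
        (by simp [spec_Vv, secV])
    have h' := congrArg (fun f => f r) hq
    simp only [RingHom.comp_apply, h, map_zero] at h'
    obtain ⟨s, hs⟩ := Ideal.mem_span_singleton.1 (Ideal.Quotient.eq_zero_iff_mem.1 h')
    exact ⟨s, hs⟩
  · rintro ⟨s, rfl⟩
    simp [spec_Uv]

theorem eq_one_of_mul_eq_one {p q : (ZMod 2)[X]} (h : p * q = 1) : p = 1 := by
  obtain ⟨c, hc, rfl⟩ := Polynomial.isUnit_iff.1 (IsUnit.of_mul_eq_one q h)
  fin_cases c
  · exact absurd hc not_isUnit_zero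
  · exact map_one _

/-! ### Homogeneous elements -/

theorem IsHomog.add {r r' : RUV} {p q : ℤ} (h : IsHomog r p q) (h' : IsHomog r' p q) :
    IsHomog (r + r') p q := by
  have key : r = 0 ∨ r' = 0 ∨ r = r' := by
    rcases h with h | ⟨a, rfl, hp, hq⟩ | ⟨b, rfl, hp, hq⟩ <;>
      rcases h' with h' | ⟨a', rfl, hp', hq'⟩ | ⟨b', rfl, hp', hq'⟩
    any_goals tauto
    · obtain rfl : a = a' := by omega
      tauto
    · obtain ⟨rfl, rfl⟩ : a = 0 ∧ b' = 0 := by omega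
      simp
    · obtain ⟨rfl, rfl⟩ : b = 0 ∧ a' = 0 := by omega
      simp
    · obtain rfl : b = b' := by omega
      tauto
  rcases key with rfl | rfl | rfl
  · simpa using h'
  · simpa using h
  · exact Or.inl (add_self_RUV r)

theorem IsHomog.sum {ι : Type*} (s : Finset ι) {r : ι → RUV} {p q : ℤ}
    (h : ∀ i ∈ s, IsHomog (r i) p q) : IsHomog (∑ i ∈ s, r i) p q :=
  Finset.sum_induction r (fun x => IsHomog x p q) (fun _ _ => IsHomog.add) (Or.inl rfl) h

theorem Uv_pow_mul_Vv_pow {a b : ℕ} (ha : a ≠ 0) (hb : b ≠ 0) : Uv ^ a * Vv ^ b = 0 := by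
  obtain ⟨a, rfl⟩ := Nat.exists_eq_succ_of_ne_zero ha
  obtain ⟨b, rfl⟩ := Nat.exists_eq_succ_of_ne_zero hb
  rw [Nat.succ_eq_add_one, Nat.succ_eq_add_one, pow_succ, pow_succ', mul_assoc, ← mul_assoc Uv,
    Uv_mul_Vv, zero_mul, mul_zero]

theorem IsHomog.mul {r r' : RUV} {p q p' q' : ℤ} (h : IsHomog r p q) (h' : IsHomog r' p' q') :
    IsHomog (r * r') (p + p') (q + q') := by
  rcases h with rfl | ⟨a, rfl, rfl, rfl⟩ | ⟨b, rfl, rfl, rfl⟩ <;>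
    rcases h' with rfl | ⟨a', rfl, rfl, rfl⟩ | ⟨b', rfl, rfl, rfl⟩
  any_goals first | exact Or.inl (zero_mul _) | exact Or.inl (mul_zero _)
  · exact Or.inr (Or.inl ⟨a + a', by rw [pow_add], by push_cast; ring, by simp⟩)
  · by_cases ha : a = 0
    · subst ha
      exact Or.inr (Or.inr ⟨b', by simp, by simp, by simp⟩)
    by_cases hb : b' = 0
    · subst hb
      exact Or.inr (Or.inl ⟨a, by simp, by simp, by simp⟩)
    exact Or.inl (Uv_pow_mul_Vv_pow ha hb)
  · by_cases ha : a' = 0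
    · subst ha
      exact Or.inr (Or.inr ⟨b, by simp, by simp, by simp⟩)
    by_cases hb : b = 0
    · subst hb
      exact Or.inr (Or.inl ⟨a', by simp, by simp, by simp⟩)
    exact Or.inl (by rw [mul_comm, Uv_pow_mul_Vv_pow ha hb])
  · exact Or.inr (Or.inr ⟨b + b', by rw [pow_add], by simp, by push_cast; ring⟩)

theorem IsHomog.nonpos {r : RUV} {p q : ℤ} (h : IsHomog r p q) (hr : r ≠ 0) : p ≤ 0 := by
  rcases h with h | ⟨a, -, hp, -⟩ | ⟨b, -, hp, -⟩
  · exact absurd h hr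
  · omega
  · omega

theorem IsHomog.eq_zero_of_spec_eq_one {r : RUV} {p q : ℤ} (h : IsHomog r p q)
    (hr : spec 1 r = 1) : q = 0 := by
  rcases h with rfl | ⟨a, -, -, hq⟩ | ⟨b, rfl, -, hq⟩
  · simp at hr
  · exact hq
  · have := congrArg natDegree hr
    simp [spec_Vv] at this
    simp [hq, this]

theorem IsHomog.eq_zero_or_one {r : RUV} (h : IsHomog r 0 0) : r = 0 ∨ r = 1 := by
  rcases h with rfl | ⟨a, rfl, ha, -⟩ | ⟨b, rfl, -, hb⟩
  · exact Or.inl rfl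
  · obtain rfl : a = 0 := by omega
    simp
  · obtain rfl : b = 0 := by omega
    simp

/-! ### Matrices of maps between complexes -/

/-- The matrix of a linear map between pre-complexes, acting on row vectors. -/
def mat {C D : PreCx} (f : Msub C →ₗ[RUV] Msub D) : Matrix (Fin C.n) (Fin D.n) RUV :=
  fun i j => f (Finsupp.single i 1) j

/-- The differential of a pre-complex as a matrix acting on row vectors. -/
def diff (C : PreCx) : Matrix (Fin C.n) (Fin C.n) RUV := C.dm

theorem map_apply_eq_sum {C D : PreCx} (f : Msub C →ₗ[RUV] Msub D) (x : Msub C) (j : Fin D.n) :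
    f x j = ∑ i, x i * mat f i j := by
  conv_lhs => rw [← Finsupp.univ_sum_single x]
  simp only [map_sum, Finsupp.finsetSum_apply, mat]
  refine Finset.sum_congr rfl fun i _ => ?_
  rw [← mul_one (x i), ← smul_eq_mul, ← Finsupp.smul_single, map_smul]
  simp

theorem mat_mul_mat {C D E : PreCx} (f : Msub C →ₗ[RUV] Msub D) (g : Msub D →ₗ[RUV] Msub E)
    (i : Fin C.n) (j : Fin E.n) : (mat f * mat g) i j = g (f (Finsupp.single i 1)) j := by
  rw [map_apply_eq_sum g, Matrix.mul_apply]
  rfl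

theorem mat_dmap (C : PreCx) : mat (dmap C) = diff C := by
  ext i j
  simp [mat, dmap, diff, Finsupp.single_apply]

theorem mat_comm {C D : PreCx} {f : Msub C →ₗ[RUV] Msub D}
    (h : ∀ x, f (dmap C x) = dmap D (f x)) : diff C * mat f = mat f * diff D := by
  ext i j
  rw [← mat_dmap, ← mat_dmap, mat_mul_mat, mat_mul_mat, h]

/-- A matrix which is homogeneous of bidegree `(0, s)`. -/
def GradedMat (C D : PreCx) (A : Matrix (Fin C.n) (Fin D.n) RUV) (s : ℤ) : Prop :=
  ∀ i j, IsHomog (A i j) ((C.gr i).1 - (D.gr j).1) ((C.gr i).2 + s - (D.gr j).2)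

theorem GradedMat.mul {C D E : PreCx} {A : Matrix (Fin C.n) (Fin D.n) RUV}
    {B : Matrix (Fin D.n) (Fin E.n) RUV} {s t : ℤ} (hA : GradedMat C D A s)
    (hB : GradedMat D E B t) : GradedMat C E (A * B) (s + t) := by
  intro i j
  rw [Matrix.mul_apply]
  refine IsHomog.sum _ fun k _ => ?_
  convert (hA i k).mul (hB k j) using 1 <;> ring

theorem MapHomogShift.gradedMat {C D : PreCx} {f : Msub C →ₗ[RUV] Msub D} {s : ℤ}
    (h : MapHomogShift C D f 0 s) : GradedMat C D (mat f) s := by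
  intro i j
  simpa [mat] using h i j

/-! ### Contractions onto a tower -/

/-- The square matrix `M`, regarded as a differential acting on row vectors, splits off the
basis vector `e` and contracts onto it up to the scalar `κ`. -/
structure IsTower {ι S : Type*} [Fintype ι] [DecidableEq ι] [CommRing S] (κ : S)
    (M : Matrix ι ι S) (e : ι) : Prop where
  row : ∀ j, M e j = 0
  col : ∀ i, M i e = 0
  htpy : ∃ H : Matrix ι ι S, M * H + H * M = κ • (1 - Matrix.single e e 1)

section Tower

variable {ι ι' S T : Type*} [Fintype ι] [DecidableEq ι] [Fintype ι'] [DecidableEq ι']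
  [CommRing S] [CommRing T]

theorem IsTower.map {κ : S} {M : Matrix ι ι S} {e : ι} (h : IsTower κ M e) (f : S →+* T) :
    IsTower (f κ) (M.map f) e := by
  obtain ⟨H, hH⟩ := h.htpy
  refine ⟨fun j => by simp [h.row], fun i => by simp [h.col], H.map f, ?_⟩
  rw [← Matrix.map_mul, ← Matrix.map_mul, ← Matrix.map_add f (map_add f), hH]
  ext i j
  simp [Matrix.one_apply, Matrix.single_apply, apply_ite f]

theorem IsTower.submatrix {κ : S} {M : Matrix ι ι S} {e : ι} (h : IsTower κ M e) (σ : ι' ≃ ι) :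
    IsTower κ (M.submatrix σ σ) (σ.symm e) := by
  obtain ⟨H, hH⟩ := h.htpy
  refine ⟨fun j => by simp [h.row], fun i => by simp [h.col], H.submatrix σ σ, ?_⟩
  rw [Matrix.submatrix_mul_equiv, Matrix.submatrix_mul_equiv]
  have := congrArg (fun A => A.submatrix σ σ) hH
  refine Eq.trans this ?_
  ext i j
  simp [Matrix.one_apply, Matrix.single_apply, Equiv.symm_apply_eq]

theorem IsTower.exists_eq {κ : S} {M : Matrix ι ι S} {e : ι} (h : IsTower κ M e) {z : ι → S}
    (hz : z ᵥ* M = 0) : ∃ y : ι → S, y ᵥ* M = κ • (z - Pi.single e (z e)) := by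
  obtain ⟨H, hH⟩ := h.htpy
  refine ⟨z ᵥ* H, ?_⟩
  have h1 : z ᵥ* (M * H + H * M) = (z ᵥ* H) ᵥ* M := by
    rw [Matrix.vecMul_add, ← Matrix.vecMul_vecMul, hz, Matrix.zero_vecMul, zero_add,
      Matrix.vecMul_vecMul]
  rw [← h1, hH, Matrix.vecMul_smul, Matrix.vecMul_sub, Matrix.vecMul_one]
  congr 2
  ext j
  simp [Matrix.vecMul, dotProduct, Matrix.single_apply, Pi.single_apply, eq_comm, ite_and]

theorem IsTower.dotProduct_eq {M : Matrix ι ι S} {e : ι} (h : IsTower 1 M e) {z c : ι → S}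
    (hz : z ᵥ* M = 0) (hc : M *ᵥ c = 0) : z ⬝ᵥ c = z e * c e := by
  obtain ⟨y, hy⟩ := h.exists_eq hz
  have h1 : (y ᵥ* M) ⬝ᵥ c = 0 := by rw [← Matrix.dotProduct_mulVec, hc, dotProduct_zero]
  rw [hy, one_smul, sub_dotProduct, single_dotProduct, sub_eq_zero] at h1
  exact h1

theorem IsTower.kronecker [CharP S 2] {M : Matrix ι ι S} {M' : Matrix ι' ι' S} {e : ι} {e' : ι'}
    (h : IsTower 1 M e) (h' : IsTower 1 M' e') :
    IsTower 1 (M ⊗ₖ (1 : Matrix ι' ι' S) + (1 : Matrix ι ι S) ⊗ₖ M') (e, e') := by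
  obtain ⟨H, hH⟩ := h.htpy
  obtain ⟨H', hH'⟩ := h'.htpy
  set E : Matrix ι ι S := Matrix.single e e 1 with hE
  set E' : Matrix ι' ι' S := Matrix.single e' e' 1 with hE'
  have hME : M * E = 0 := by
    ext i j
    simp [hE, Matrix.mul_apply, Matrix.single_apply, ite_and, h.col]
  have hEM : E * M = 0 := by
    ext i j
    simp [hE, Matrix.mul_apply, Matrix.single_apply, ite_and, h.row]
  refine ⟨?_, ?_, H ⊗ₖ 1 + E ⊗ₖ H', ?_⟩
  · rintro ⟨i, j⟩
    simp [h.row, h'.row]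
  · rintro ⟨i, j⟩
    simp [h.col, h'.col]
  have h2 : H ⊗ₖ M' + H ⊗ₖ M' = 0 := by
    ext i j
    exact CharTwo.add_self_eq_zero _
  have hEE : Matrix.single (e, e') (e, e') (1 : S) = E ⊗ₖ E' := by
    ext ⟨i, i'⟩ ⟨j, j'⟩
    simp only [Matrix.single_apply, hE, hE', Matrix.kroneckerMap_apply, Prod.mk.injEq, mul_ite,
      mul_one, mul_zero, ← ite_and]
    congr 1
    simp only [eq_iff_iff]
    tauto
  have e1 : M ⊗ₖ (1 : Matrix ι' ι' S) * H ⊗ₖ (1 : Matrix ι' ι' S)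
      + H ⊗ₖ (1 : Matrix ι' ι' S) * M ⊗ₖ (1 : Matrix ι' ι' S)
      = 1 - E ⊗ₖ (1 : Matrix ι' ι' S) := by
    rw [← Matrix.mul_kronecker_mul, ← Matrix.mul_kronecker_mul, ← Matrix.add_kronecker, hH,
      one_smul, Matrix.one_mul]
    ext ⟨i, i'⟩ ⟨j, j'⟩
    rw [← Matrix.one_kronecker_one (α := S)]
    exact sub_mul _ _ _
  have e2 : (1 : Matrix ι ι S) ⊗ₖ M' * E ⊗ₖ H' + E ⊗ₖ H' * (1 : Matrix ι ι S) ⊗ₖ M'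
      = E ⊗ₖ (1 : Matrix ι' ι' S) - E ⊗ₖ E' := by
    rw [← Matrix.mul_kronecker_mul, ← Matrix.mul_kronecker_mul, Matrix.one_mul, Matrix.mul_one,
      ← Matrix.kronecker_add, hH', one_smul]
    ext ⟨i, i'⟩ ⟨j, j'⟩
    simp [mul_sub]
  have e3 : M ⊗ₖ (1 : Matrix ι' ι' S) * E ⊗ₖ H' = 0 := by
    rw [← Matrix.mul_kronecker_mul, hME, Matrix.zero_kronecker]
  have e4 : E ⊗ₖ H' * M ⊗ₖ (1 : Matrix ι' ι' S) = 0 := by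
    rw [← Matrix.mul_kronecker_mul, hEM, Matrix.zero_kronecker]
  have e5 : (1 : Matrix ι ι S) ⊗ₖ M' * H ⊗ₖ (1 : Matrix ι' ι' S)
      + H ⊗ₖ (1 : Matrix ι' ι' S) * (1 : Matrix ι ι S) ⊗ₖ M' = 0 := by
    rw [← Matrix.mul_kronecker_mul, ← Matrix.mul_kronecker_mul]
    simpa using h2
  rw [hEE, one_smul]
  calc _ = (M ⊗ₖ (1 : Matrix ι' ι' S) * H ⊗ₖ (1 : Matrix ι' ι' S)
      + H ⊗ₖ (1 : Matrix ι' ι' S) * M ⊗ₖ (1 : Matrix ι' ι' S))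
      + ((1 : Matrix ι ι S) ⊗ₖ M' * E ⊗ₖ H' + E ⊗ₖ H' * (1 : Matrix ι ι S) ⊗ₖ M')
      + M ⊗ₖ (1 : Matrix ι' ι' S) * E ⊗ₖ H' + E ⊗ₖ H' * M ⊗ₖ (1 : Matrix ι' ι' S)
      + ((1 : Matrix ι ι S) ⊗ₖ M' * H ⊗ₖ (1 : Matrix ι' ι' S)
      + H ⊗ₖ (1 : Matrix ι' ι' S) * (1 : Matrix ι ι S) ⊗ₖ M') := by
        noncomm_ring
    _ = _ := by rw [e1, e2, e3, e4, e5]; abel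

/-- The matrix whose `i`-th row is `w i` at position `π i` when `s i` holds, and zero otherwise. -/
def arrowMat (s : ι → Prop) [DecidablePred s] (π : ι → ι) (w : ι → S) : Matrix ι ι S :=
  fun i j => if s i ∧ j = π i then w i else 0

theorem isTower_arrowMat {s : ι → Prop} [DecidablePred s] {π : ι → ι} {w w' : ι → S} {e : ι}
    {κ : S} (hπ : ∀ i, π (π i) = i) (hse : ¬ s e) (hπe : π e = e)
    (hs : ∀ i, i ≠ e → (s (π i) ↔ ¬ s i)) (hw : ∀ i, s i → w i * w' i = κ) :
    IsTower κ (arrowMat s π w) e := by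
  have hinv : ∀ i j, i = π j ↔ j = π i := fun i j =>
    ⟨fun h => by rw [h, hπ], fun h => by rw [h, hπ]⟩
  refine ⟨fun j => by simp [arrowMat, hse], fun i => ?_, (arrowMat s π w')ᵀ, ?_⟩
  · unfold arrowMat
    refine if_neg ?_
    rintro ⟨hi, h⟩
    rw [hinv, hπe] at h
    exact hse (h ▸ hi)
  · ext i j
    have h1 : (arrowMat s π w * (arrowMat s π w')ᵀ) i j = if i = j ∧ s i then κ else 0 := by
      rw [Matrix.mul_apply, Finset.sum_eq_single (π i)]
      · by_cases hij : i = j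
        · subst hij
          by_cases hi : s i <;> simp [arrowMat, hi, hw]
        · have : π i ≠ π j := fun h => hij (by rw [← hπ i, h, hπ])
          simp [arrowMat, hij, this]
      · intro k _ hk
        simp [arrowMat, hk]
      · simp
    have h2 : ((arrowMat s π w')ᵀ * arrowMat s π w) i j
        = if i = j ∧ s (π i) then κ else 0 := by
      rw [Matrix.mul_apply, Finset.sum_eq_single (π i)]
      · by_cases hij : i = j
        · subst hij
          by_cases hi : s (π i) <;> simp [arrowMat, hi, hπ, mul_comm (w' _), hw]
        · have : j ≠ i := fun h => hij h.symm
          simp [arrowMat, hij, this, hπ]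
      · intro k _ hk
        have : i ≠ π k := fun h => hk ((hinv _ _).1 h)
        simp [arrowMat, this]
      · simp
    rw [Matrix.add_apply, h1, h2, Matrix.smul_apply, Matrix.sub_apply, Matrix.one_apply,
      Matrix.single_apply]
    by_cases hij : i = j
    · subst hij
      by_cases hie : i = e
      · subst hie
        simp [hse, hπe]
      · by_cases hi : s i <;> simp [hi, hs i hie, Ne.symm hie]
    · have : ¬ (e = i ∧ e = j) := fun h => hij (h.1.symm.trans h.2)
      simp [hij, this]

theorem arrowMat_comm_diag [IsDomain S] {s : ι → Prop} [DecidablePred s] {π : ι → ι} {w : ι → S}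
    (hπ : ∀ i, π (π i) = i) (hw : ∀ i, w i ≠ 0) {H : Matrix ι ι S}
    (hH : arrowMat s π w * H = H * arrowMat s π w) {i : ι} (hi : s i) :
    H i i = H (π i) (π i) := by
  have h := congrFun (congrFun hH i) (π i)
  rw [Matrix.mul_apply, Matrix.mul_apply, Finset.sum_eq_single (π i), Finset.sum_eq_single i] at h
  · simp only [arrowMat, hi, and_self, if_true] at h
    rw [mul_comm] at h
    exact (mul_right_cancel₀ (hw i) h).symm
  · intro k _ hk
    have : π i ≠ π k := fun h => hk (by rw [← hπ k, ← h, hπ])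
    simp [arrowMat, this]
  · simp
  · intro k _ hk
    simp [arrowMat, hk]
  · simp

end Tower

/-! ### Standard complexes -/

/-- The partner of the generator `i` along an arrow of kind `t`. -/
def stdPartner (n : ℕ) (t i : ℕ) : ℕ :=
  if i % 2 = t then (if i < n then i + 1 else i) else i - 1

/-- The generator `i` is the source of an arrow of kind `t`. -/
def StdSource (L : List ℤ) (t i : ℕ) : Prop :=
  (i % 2 = t ∧ L.getD i 0 < 0) ∨ (i % 2 ≠ t ∧ 0 < i ∧ 0 < L.getD (i - 1) 0)

instance (L : List ℤ) (t i : ℕ) : Decidable (StdSource L t i) := by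
  unfold StdSource
  infer_instance

/-- The length of the arrow of kind `t` at the generator `i`. -/
def stdLength (L : List ℤ) (t i : ℕ) : ℕ :=
  if i % 2 = t then (L.getD i 0).natAbs else (L.getD (i - 1) 0).natAbs

/-- The generator of a standard complex not adjacent to an arrow of kind `t`. -/
def stdEnd (L : List ℤ) (t : Fin 2) : Fin (StdCx L).n :=
  if t = 0 then Fin.last L.length else (0 : Fin (L.length + 1))

theorem stdEnd_val (L : List ℤ) (t : Fin 2) :
    (stdEnd L t : ℕ) = if (t : ℕ) = 0 then L.length else 0 := by
  fin_cases t <;> simp [stdEnd, StdCx]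

theorem stdPartner_lt {n t i : ℕ} (hi : i < n + 1) : stdPartner n t i < n + 1 := by
  unfold stdPartner
  split_ifs <;> omega

/-- `stdPartner` as a self-map of the generators. -/
def stdPi (L : List ℤ) (t : Fin 2) (i : Fin (StdCx L).n) : Fin (StdCx L).n :=
  ⟨stdPartner L.length t i, stdPartner_lt i.2⟩

theorem getD_ne_zero {L : List ℤ} (hL : IsStdSeq L) {i : ℕ} (hi : i < L.length) :
    L.getD i 0 ≠ 0 := by
  rw [List.getD_eq_getElem _ _ hi]
  exact hL.1 _ (List.getElem_mem hi)

theorem getD_eq_zero_of_le {L : List ℤ} {i : ℕ} (hi : L.length ≤ i) : L.getD i 0 = 0 :=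
  List.getD_eq_default _ _ hi

theorem stdPi_involutive {L : List ℤ} (hL : IsStdSeq L) (t : Fin 2) (i : Fin (StdCx L).n) :
    stdPi L t (stdPi L t i) = i := by
  obtain ⟨k, hk⟩ := hL.2
  have hi : (i : ℕ) < L.length + 1 := i.2
  have ht := t.2
  ext
  simp only [stdPi, stdPartner]
  split_ifs <;> omega

theorem stdPi_stdEnd {L : List ℤ} (hL : IsStdSeq L) (t : Fin 2) :
    stdPi L t (stdEnd L t) = stdEnd L t := by
  obtain ⟨k, hk⟩ := hL.2
  have ht := t.2
  ext
  simp only [stdPi, stdPartner, stdEnd_val]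
  split_ifs <;> omega

theorem not_stdSource_stdEnd {L : List ℤ} (hL : IsStdSeq L) (t : Fin 2) :
    ¬ StdSource L t (stdEnd L t) := by
  obtain ⟨k, hk⟩ := hL.2
  have ht := t.2
  have h0 : L.getD L.length 0 = 0 := getD_eq_zero_of_le le_rfl
  unfold StdSource
  rw [stdEnd_val]
  split_ifs with h
  · rw [h0]
    omega
  · omega

theorem stdSource_stdPi {L : List ℤ} (hL : IsStdSeq L) (t : Fin 2) {i : Fin (StdCx L).n}
    (hi : i ≠ stdEnd L t) : StdSource L t (stdPi L t i) ↔ ¬ StdSource L t i := by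
  obtain ⟨k, hk⟩ := hL.2
  have ht := t.2
  have hi' : (i : ℕ) ≠ if (t : ℕ) = 0 then L.length else 0 := by
    rw [← stdEnd_val]
    exact fun h => hi (Fin.ext h)
  have hlt : (i : ℕ) < L.length + 1 := i.2
  unfold StdSource stdPi stdPartner
  by_cases h : (i : ℕ) % 2 = t
  · have hl : (i : ℕ) < L.length := by
      split_ifs at hi' <;> omega
    have hne := getD_ne_zero hL hl
    have : ¬ ((i : ℕ) + 1) % 2 = t := by omega
    simp only [h, hl, if_true, this, Nat.add_sub_cancel, false_and, false_or, true_and, ne_eq,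
      not_true, or_false, not_false_iff]
    omega
  · have hl : 0 < (i : ℕ) := by
      split_ifs at hi' <;> omega
    have hne := getD_ne_zero hL (i := (i : ℕ) - 1) (by omega)
    have : ((i : ℕ) - 1) % 2 = t := by omega
    simp only [h, if_false, this, false_and, false_or, true_and, ne_eq, not_true, or_false,
      not_false_iff]
    omega

theorem spec_stdDm {L : List ℤ} (hL : IsStdSeq L) (t : Fin 2) :
    (diff (StdCx L)).map (spec t) = arrowMat (fun i : Fin (StdCx L).n => StdSource L t i) (stdPi L t)
      (fun i => X ^ stdLength L t i) := by
  ext1 i j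
  have hlt : (i : ℕ) < L.length + 1 := i.2
  have hlt' : (j : ℕ) < L.length + 1 := j.2
  have ht := t.2
  have hspec : ∀ k : ℕ, k < L.length →
      spec t ((if k % 2 = 0 then Uv else Vv) ^ (L.getD k 0).natAbs) =
        if k % 2 = t then X ^ (L.getD k 0).natAbs else 0 := by
    intro k hk
    have hne : (L.getD k 0).natAbs ≠ 0 := Int.natAbs_ne_zero.2 (getD_ne_zero hL hk)
    rcases Nat.mod_two_eq_zero_or_one k with h | h <;> fin_cases t <;>
      simp [h, spec_Uv, spec_Vv, zero_pow hne, -List.getD_eq_getElem?_getD]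
  have hji : j = stdPi L t i ↔ (j : ℕ) = stdPartner L.length t i := Fin.ext_iff
  change spec t (stdDm L i j) =
    if StdSource L t i ∧ j = stdPi L t i then X ^ stdLength L t i else 0
  refine Eq.trans ?_ (if_congr (and_congr Iff.rfl hji) rfl rfl).symm
  unfold stdDm StdSource stdPartner stdLength
  by_cases h1 : (j : ℕ) = i + 1 ∧ L.getD i 0 < 0
  · rw [if_pos h1, hspec _ (by omega)]
    have : (i : ℕ) < L.length := by omega
    by_cases h : (i : ℕ) % 2 = t
    · simp [h, h1.1, this, h1.2, -List.getD_eq_getElem?_getD]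
    · rw [if_neg h, if_neg]
      rw [if_neg h]
      omega
  · rw [if_neg h1]
    by_cases h2 : (i : ℕ) = j + 1 ∧ 0 < L.getD j 0
    · rw [if_pos h2, hspec _ (by omega)]
      have hj : (i : ℕ) - 1 = j := by omega
      by_cases h : (i : ℕ) % 2 = t
      · rw [if_neg (by omega), if_neg]
        rw [if_pos h]
        split_ifs <;> omega
      · rw [if_pos (by omega), if_pos]
        · rw [if_neg h, hj]
        · rw [if_neg h, hj]
          refine ⟨Or.inr ⟨h, by omega, h2.2⟩, rfl⟩
    · rw [if_neg h2, map_zero, if_neg]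
      rintro ⟨h3 | ⟨h3, h4, h5⟩, h6⟩
      · have : (i : ℕ) < L.length := by
          by_contra hcon
          rw [getD_eq_zero_of_le (not_lt.1 hcon)] at h3
          omega
        rw [if_pos h3.1, if_pos this] at h6
        exact h1 ⟨h6, h3.2⟩
      · rw [if_neg h3] at h6
        rw [← h6] at h5
        exact h2 ⟨by omega, h5⟩

theorem natAbs_getD_le (L : List ℤ) (i : ℕ) : (L.getD i 0).natAbs ≤ (L.map Int.natAbs).sum := by
  by_cases h : i < L.length
  · rw [List.getD_eq_getElem _ _ h]
    exact List.single_le_sum (by simp) _ (List.mem_map_of_mem (List.getElem_mem h))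
  · rw [getD_eq_zero_of_le (not_lt.1 h)]
    simp

theorem isTower_stdCx {L : List ℤ} (hL : IsStdSeq L) (t : Fin 2) :
    ∃ k : ℕ, IsTower (X ^ k) ((diff (StdCx L)).map (spec t)) (stdEnd L t) := by
  refine ⟨(L.map Int.natAbs).sum, ?_⟩
  rw [spec_stdDm hL]
  refine isTower_arrowMat (s := fun i : Fin (StdCx L).n => StdSource L t i)
    (w' := fun i => X ^ ((L.map Int.natAbs).sum - stdLength L t i))
    (stdPi_involutive hL t) (not_stdSource_stdEnd hL t) (stdPi_stdEnd hL t)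
    (fun i hi => stdSource_stdPi hL t hi) (fun i _ => ?_)
  rw [← pow_add, Nat.add_sub_cancel']
  unfold stdLength
  split_ifs <;> exact natAbs_getD_le _ _

/-- The specialization of `R` to `𝔽₂` at which one of `U`, `V` vanishes and the other is `1`. -/
def specOne (t : Fin 2) : RUV →+* ZMod 2 := (evalRingHom 1).comp (spec t)

theorem isTower_specOne_stdCx {L : List ℤ} (hL : IsStdSeq L) (t : Fin 2) :
    IsTower 1 ((diff (StdCx L)).map (specOne t)) (stdEnd L t) := by
  obtain ⟨k, hk⟩ := isTower_stdCx hL t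
  simpa [specOne, Matrix.map_map, Function.comp_def] using hk.map (evalRingHom (1 : ZMod 2))

theorem eval_zero_diag_eq {L : List ℤ} (hL : IsStdSeq L)
    {H : Matrix (Fin (StdCx L).n) (Fin (StdCx L).n) RUV}
    (hH : diff (StdCx L) * H = H * diff (StdCx L)) :
    (spec 0 (H (stdEnd L 0) (stdEnd L 0))).eval 0 =
      (spec 0 (H (stdEnd L 1) (stdEnd L 1))).eval 0 := by
  have step : ∀ (t : Fin 2) (i : Fin (StdCx L).n),
      (spec 0 (H i i)).eval 0 = (spec 0 (H (stdPi L t i) (stdPi L t i))).eval 0 := by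
    intro t i
    have hH' : (diff (StdCx L)).map (spec t) * H.map (spec t) =
        H.map (spec t) * (diff (StdCx L)).map (spec t) := by
      rw [← Matrix.map_mul, ← Matrix.map_mul, hH]
    rw [spec_stdDm hL] at hH'
    rw [eval_zero_spec 0 t, eval_zero_spec 0 t]
    have key := fun (j : Fin (StdCx L).n) (hj : StdSource L t j) =>
      arrowMat_comm_diag (i := j)
      (s := fun i : Fin (StdCx L).n => StdSource L t i) (stdPi_involutive hL t)
      (fun i => pow_ne_zero _ X_ne_zero) hH' hj
    simp only [Matrix.map_apply] at key
    by_cases hi : i = stdEnd L t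
    · rw [hi, stdPi_stdEnd hL]
    by_cases hs : StdSource L t i
    · rw [key i hs]
    · have := key (stdPi L t i) ((stdSource_stdPi hL t hi).2 hs)
      rw [stdPi_involutive hL] at this
      rw [this]
  have main : ∀ (k : ℕ) (hk : k < L.length + 1),
      (spec 0 (H ⟨k, hk⟩ ⟨k, hk⟩)).eval 0 = (spec 0 (H (stdEnd L 1) (stdEnd L 1))).eval 0 := by
    intro k
    induction k with
    | zero =>
      intro hk
      have : stdEnd L 1 = ⟨0, hk⟩ := Fin.ext (by rw [stdEnd_val]; simp)
      rw [this]
    | succ k ih =>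
      intro hk
      rw [← ih (Nat.lt_of_succ_lt hk), step ⟨k % 2, Nat.mod_lt _ two_pos⟩ ⟨k, Nat.lt_of_succ_lt hk⟩]
      have : stdPi L ⟨k % 2, Nat.mod_lt _ two_pos⟩ ⟨k, Nat.lt_of_succ_lt hk⟩ = ⟨k + 1, hk⟩ := by
        ext
        simp only [stdPi, stdPartner, if_true]
        rw [if_pos (Nat.lt_of_succ_lt_succ hk)]
      rw [this]
  exact main _ (stdEnd L 0).2

/-! ### Tower generators -/

/-- The reduction of a chain modulo `U`. -/
def specVec {C : PreCx} (x : Msub C) : Fin C.n → (ZMod 2)[X] := fun i => spec 1 (x i)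

theorem mem_uSub_iff {C : PreCx} {x : Msub C} : x ∈ uSub C ↔ specVec x = 0 := by
  constructor
  · rintro ⟨y, rfl⟩
    ext1 j
    simp [specVec, spec_Uv]
  · intro h
    choose s hs using fun j => (spec_one_eq_zero_iff (x j)).1 (congrFun h j)
    refine ⟨Finsupp.equivFunOnFinite.symm s, ?_⟩
    ext j
    simp [hs j]

theorem specVec_add {C : PreCx} (x y : Msub C) : specVec (x + y) = specVec x + specVec y := by
  ext1 j
  simp [specVec]

theorem specVec_sub {C : PreCx} (x y : Msub C) : specVec (x - y) = specVec x - specVec y := by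
  ext1 j
  simp [specVec]

theorem specVec_smul {C : PreCx} (r : RUV) (x : Msub C) :
    specVec (r • x) = spec 1 r • specVec x := by
  ext1 j
  simp [specVec]

theorem specVec_single {C : PreCx} (i : Fin C.n) :
    specVec (Finsupp.single i 1 : Msub C) = Pi.single i 1 := by
  ext1 j
  simp [specVec, Finsupp.single_apply, Pi.single_apply, eq_comm, apply_ite (spec 1)]

theorem specVec_map {C D : PreCx} (f : Msub C →ₗ[RUV] Msub D) (x : Msub C) :
    specVec (f x) = specVec x ᵥ* (mat f).map (spec 1) := by
  ext1 j
  simp [specVec, map_apply_eq_sum f x, Matrix.vecMul, dotProduct]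

theorem specVec_dmap {C : PreCx} (x : Msub C) :
    specVec (dmap C x) = specVec x ᵥ* (diff C).map (spec 1) := by
  rw [specVec_map, mat_dmap]

theorem specVec_dotProduct_eq_zero {C : PreCx} {ℓ : Fin C.n → (ZMod 2)[X]}
    (hℓ : (diff C).map (spec 1) *ᵥ ℓ = 0) {x : Msub C} (hx : x ∈ bdryU C) :
    specVec x ⬝ᵥ ℓ = 0 := by
  obtain ⟨u, hu, _, ⟨y, rfl⟩, rfl⟩ := Submodule.mem_sup.1 hx
  rw [specVec_add, mem_uSub_iff.1 hu, zero_add, specVec_dmap, ← Matrix.dotProduct_mulVec, hℓ,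
    dotProduct_zero]

theorem IsVTowerGen.exists_ratio {C : PreCx} {w z : Msub C} (hw : IsVTowerGen C w)
    (hz : dmap C z ∈ uSub C) : ∃ ρ : (ZMod 2)[X], ∀ ℓ : Fin C.n → (ZMod 2)[X],
      (diff C).map (spec 1) *ᵥ ℓ = 0 → specVec z ⬝ᵥ ℓ = ρ * (specVec w ⬝ᵥ ℓ) := by
  obtain ⟨r, k, h⟩ := hw.2.2 z hz
  refine ⟨spec 1 r, fun ℓ hℓ => ?_⟩
  have h' := specVec_dotProduct_eq_zero hℓ h
  rw [specVec_smul, specVec_sub, specVec_smul, smul_dotProduct, sub_dotProduct, smul_dotProduct,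
    smul_eq_mul, smul_eq_mul, map_pow, spec_Vv, if_pos rfl] at h'
  exact sub_eq_zero.1 ((mul_eq_zero.1 h').resolve_left (pow_ne_zero _ X_ne_zero))

theorem stdCx_mulVec_single {L : List ℤ} (hL : IsStdSeq L) :
    (diff (StdCx L)).map (spec 1) *ᵥ Pi.single (stdEnd L 1) 1 = 0 := by
  obtain ⟨k, hk⟩ := isTower_stdCx hL 1
  ext1 i
  simpa using hk.col i

theorem single_vecMul_stdCx {L : List ℤ} (hL : IsStdSeq L) :
    Pi.single (stdEnd L 1) 1 ᵥ* (diff (StdCx L)).map (spec 1) = 0 := by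
  obtain ⟨k, hk⟩ := isTower_stdCx hL 1
  ext1 i
  simpa using hk.row i

theorem isVTowerGen_stdCx {L : List ℤ} (hL : IsStdSeq L) :
    IsVTowerGen (StdCx L) (Finsupp.single (stdEnd L 1) 1) := by
  refine ⟨?_, fun k hk => ?_, fun z hz => ?_⟩
  · rw [mem_uSub_iff, specVec_dmap, specVec_single, single_vecMul_stdCx hL]
  · have h := specVec_dotProduct_eq_zero (stdCx_mulVec_single hL) hk
    rw [specVec_smul, specVec_single] at h
    simp [spec_Vv] at h
  · obtain ⟨k, hk⟩ := isTower_stdCx hL 1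
    rw [mem_uSub_iff, specVec_dmap] at hz
    obtain ⟨y, hy⟩ := hk.exists_eq hz
    refine ⟨z (stdEnd L 1), k, ?_⟩
    set Y : Msub (StdCx L) := Finsupp.equivFunOnFinite.symm fun i => secV (y i) with hY
    have hYy : specVec Y = y := by
      ext1 i
      simp [specVec, hY, spec_secV]
    refine Submodule.mem_sup.2 ⟨_, mem_uSub_iff.2 ?_, dmap _ Y, ⟨Y, rfl⟩, sub_add_cancel _ _⟩
    rw [specVec_sub, specVec_dmap, hYy, hy, specVec_smul, specVec_sub, specVec_smul,
      specVec_single, map_pow, spec_Vv, if_pos rfl, sub_eq_zero]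
    congr 2
    ext1 i
    simp [Pi.single_apply, specVec]

theorem IsVTowerGen.spec_coeff_eq_one {L : List ℤ} (hL : IsStdSeq L) {w : Msub (StdCx L)}
    (hw : IsVTowerGen (StdCx L) w) : spec 1 (w (stdEnd L 1)) = 1 := by
  obtain ⟨ρ, hρ⟩ := hw.exists_ratio (isVTowerGen_stdCx hL).1
  have h := hρ _ (stdCx_mulVec_single hL)
  rw [specVec_single, dotProduct_single, dotProduct_single, Pi.single_eq_same, mul_one, mul_one,
    mul_comm] at h
  exact eq_one_of_mul_eq_one h.symm

/-! ### Comparison of towers -/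

theorem specOne_diag_mul {L : List ℤ} (hL : IsStdSeq L) {D : PreCx}
    {A : Matrix (Fin D.n) (Fin (StdCx L).n) RUV} {B : Matrix (Fin (StdCx L).n) (Fin D.n) RUV}
    (hA : diff D * A = A * diff (StdCx L)) (hB : diff (StdCx L) * B = B * diff D) {t : Fin 2}
    {e : Fin D.n} (he : IsTower 1 ((diff D).map (specOne t)) e) :
    specOne t ((B * A) (stdEnd L t) (stdEnd L t)) =
      specOne t (B (stdEnd L t) e) * specOne t (A e (stdEnd L t)) := by
  have hT := isTower_specOne_stdCx hL t
  have h := he.dotProduct_eq (z := fun p => specOne t (B (stdEnd L t) p))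
    (c := fun p => specOne t (A p (stdEnd L t))) ?_ ?_
  · rw [← h, Matrix.mul_apply, map_sum]
    simp [dotProduct]
  · ext1 j
    have h1 := congrArg (specOne t) (congrFun (congrFun hB (stdEnd L t)) j)
    simp only [Matrix.mul_apply, map_sum, map_mul] at h1
    have h2 := hT.row
    simp only [Matrix.map_apply] at h2
    simpa [h2, Matrix.vecMul, dotProduct] using h1.symm
  · ext1 j
    have h1 := congrArg (specOne t) (congrFun (congrFun hA j) (stdEnd L t))
    simp only [Matrix.mul_apply, map_sum, map_mul] at h1
    have h2 := hT.col
    simp only [Matrix.map_apply] at h2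
    simpa [h2, Matrix.mulVec, dotProduct] using h1

theorem gr_uTower_eq {L : List ℤ} (hL : IsStdSeq L) {D : PreCx}
    {A : Matrix (Fin D.n) (Fin (StdCx L).n) RUV} {B : Matrix (Fin (StdCx L).n) (Fin D.n) RUV}
    (hA : diff D * A = A * diff (StdCx L)) (hB : diff (StdCx L) * B = B * diff D)
    {sA sB : ℤ} (gA : GradedMat D (StdCx L) A sA) (gB : GradedMat (StdCx L) D B sB)
    {e₀ e₁ : Fin D.n} (hV : IsTower 1 ((diff D).map (specOne 1)) e₀)
    (hU : IsTower 1 ((diff D).map (specOne 0)) e₁)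
    (hB₀ : spec 1 (B (stdEnd L 1) e₀) = 1) (hA₀ : spec 1 (A e₀ (stdEnd L 1)) = 1) :
    (D.gr e₁).1 = ((StdCx L).gr (stdEnd L 0)).1 := by
  have hs : sB + sA = 0 := by
    have h1 := (gA _ _).eq_zero_of_spec_eq_one hA₀
    have h2 := (gB _ _).eq_zero_of_spec_eq_one hB₀
    omega
  have hBA := gB.mul gA
  have hhom : ∀ i, IsHomog ((B * A) i i) 0 0 := by
    intro i
    have := hBA i i
    rwa [hs, add_zero, sub_self, sub_self] at this
  have hcomm : diff (StdCx L) * (B * A) = (B * A) * diff (StdCx L) := by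
    rw [← Matrix.mul_assoc, hB, Matrix.mul_assoc, hA, Matrix.mul_assoc]
  have h0 : (B * A) (stdEnd L 1) (stdEnd L 1) = 1 := by
    refine (hhom _).eq_zero_or_one.resolve_left fun h => ?_
    have := specOne_diag_mul hL hA hB hV
    rw [h] at this
    simp [specOne, hA₀, hB₀] at this
  have h1 : (B * A) (stdEnd L 0) (stdEnd L 0) = 1 := by
    refine (hhom _).eq_zero_or_one.resolve_left fun h => ?_
    have := eval_zero_diag_eq hL hcomm
    rw [h, h0] at this
    simp at this
  have h2 := specOne_diag_mul hL hA hB hU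
  rw [h1, map_one] at h2
  have hB' : B (stdEnd L 0) e₁ ≠ 0 := by
    intro h
    simp [h] at h2
  have hA' : A e₁ (stdEnd L 0) ≠ 0 := by
    intro h
    simp [h] at h2
  have := (gA _ _).nonpos hA'
  have := (gB _ _).nonpos hB'
  omega

/-! ### Tensor products -/

/-- The tensor product of two matrices, on the bases of the tensor products of complexes. -/
def tensorMat {C₁ C₂ D₁ D₂ : PreCx} (A : Matrix (Fin C₁.n) (Fin D₁.n) RUV)
    (B : Matrix (Fin C₂.n) (Fin D₂.n) RUV) :
    Matrix (Fin (tensorCx C₁ C₂).n) (Fin (tensorCx D₁ D₂).n) RUV :=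
  (A ⊗ₖ B).submatrix (finProdFinEquiv (m := C₁.n) (n := C₂.n)).symm
    (finProdFinEquiv (m := D₁.n) (n := D₂.n)).symm

/-- The basis element `x_i ⊗ y_j` of a tensor product. -/
def tensorIdx (C₁ C₂ : PreCx) (i : Fin C₁.n) (j : Fin C₂.n) : Fin (tensorCx C₁ C₂).n :=
  finProdFinEquiv (i, j)

theorem tensorMat_tensorIdx {C₁ C₂ D₁ D₂ : PreCx} (A : Matrix (Fin C₁.n) (Fin D₁.n) RUV)
    (B : Matrix (Fin C₂.n) (Fin D₂.n) RUV) (i : Fin C₁.n) (j : Fin C₂.n) (k : Fin D₁.n)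
    (l : Fin D₂.n) :
    tensorMat A B (tensorIdx C₁ C₂ i j) (tensorIdx D₁ D₂ k l) = A i k * B j l := by
  change (A ⊗ₖ B) (finProdFinEquiv.symm (finProdFinEquiv (i, j)))
    (finProdFinEquiv.symm (finProdFinEquiv (k, l))) = _
  rw [Equiv.symm_apply_apply, Equiv.symm_apply_apply, Matrix.kroneckerMap_apply]

theorem exists_tensorIdx {C₁ C₂ : PreCx} (q : Fin (tensorCx C₁ C₂).n) :
    ∃ i j, tensorIdx C₁ C₂ i j = q := by
  obtain ⟨⟨i, j⟩, h⟩ := (finProdFinEquiv (m := C₁.n) (n := C₂.n)).surjective q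
  exact ⟨i, j, h⟩

theorem gr_tensorIdx (C₁ C₂ : PreCx) (i : Fin C₁.n) (j : Fin C₂.n) :
    (tensorCx C₁ C₂).gr (tensorIdx C₁ C₂ i j) = C₁.gr i + C₂.gr j := by
  simp [tensorCx, tensorIdx]

theorem tensorMat_mul {C₁ C₂ D₁ D₂ E₁ E₂ : PreCx} (A : Matrix (Fin C₁.n) (Fin D₁.n) RUV)
    (B : Matrix (Fin C₂.n) (Fin D₂.n) RUV) (A' : Matrix (Fin D₁.n) (Fin E₁.n) RUV)
    (B' : Matrix (Fin D₂.n) (Fin E₂.n) RUV) :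
    tensorMat A B * tensorMat A' B' = tensorMat (A * A') (B * B') := by
  unfold tensorMat
  rw [Matrix.mul_kronecker_mul]
  exact Matrix.submatrix_mul_equiv _ _ _ _ _

theorem diff_tensorCx (C₁ C₂ : PreCx) :
    diff (tensorCx C₁ C₂) = tensorMat (diff C₁) 1 + tensorMat 1 (diff C₂) := by
  ext p q
  obtain ⟨i, j, rfl⟩ := exists_tensorIdx p
  obtain ⟨k, l, rfl⟩ := exists_tensorIdx q
  rw [Matrix.add_apply, tensorMat_tensorIdx, tensorMat_tensorIdx]
  simp [diff, tensorCx, tensorIdx, Matrix.one_apply]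

theorem tensorMat_comm {C₁ C₂ D₁ D₂ : PreCx} {A : Matrix (Fin C₁.n) (Fin D₁.n) RUV}
    {B : Matrix (Fin C₂.n) (Fin D₂.n) RUV} (hA : diff C₁ * A = A * diff D₁)
    (hB : diff C₂ * B = B * diff D₂) :
    diff (tensorCx C₁ C₂) * tensorMat A B = tensorMat A B * diff (tensorCx D₁ D₂) := by
  rw [diff_tensorCx, diff_tensorCx, Matrix.add_mul, Matrix.mul_add]
  simp only [tensorMat_mul, Matrix.one_mul, Matrix.mul_one, hA, hB]

theorem GradedMat.tensorMat {C₁ C₂ D₁ D₂ : PreCx} {A : Matrix (Fin C₁.n) (Fin D₁.n) RUV}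
    {B : Matrix (Fin C₂.n) (Fin D₂.n) RUV} {s t : ℤ} (hA : GradedMat C₁ D₁ A s)
    (hB : GradedMat C₂ D₂ B t) :
    GradedMat (tensorCx C₁ C₂) (tensorCx D₁ D₂) (tensorMat A B) (s + t) := by
  intro p q
  obtain ⟨i, j, rfl⟩ := exists_tensorIdx p
  obtain ⟨k, l, rfl⟩ := exists_tensorIdx q
  rw [tensorMat_tensorIdx, gr_tensorIdx, gr_tensorIdx]
  convert (hA i k).mul (hB j l) using 1
  · rw [Prod.fst_add, Prod.fst_add]
    ring
  · rw [Prod.snd_add, Prod.snd_add]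
    ring

theorem isTower_tensorCx {C₁ C₂ : PreCx} {t : Fin 2} {e₁ : Fin C₁.n} {e₂ : Fin C₂.n}
    (h₁ : IsTower 1 ((diff C₁).map (specOne t)) e₁)
    (h₂ : IsTower 1 ((diff C₂).map (specOne t)) e₂) :
    IsTower 1 ((diff (tensorCx C₁ C₂)).map (specOne t)) (tensorIdx C₁ C₂ e₁ e₂) := by
  have h := (h₁.kronecker h₂).submatrix (finProdFinEquiv (m := C₁.n) (n := C₂.n)).symm
  have hM : (diff (tensorCx C₁ C₂)).map (specOne t) =
      ((diff C₁).map (specOne t) ⊗ₖ 1 + 1 ⊗ₖ (diff C₂).map (specOne t)).submatrix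
        (finProdFinEquiv (m := C₁.n) (n := C₂.n)).symm finProdFinEquiv.symm := by
    ext p q
    obtain ⟨i, j, rfl⟩ := exists_tensorIdx p
    obtain ⟨k, l, rfl⟩ := exists_tensorIdx q
    rw [Matrix.map_apply, diff_tensorCx, Matrix.add_apply, tensorMat_tensorIdx,
      tensorMat_tensorIdx]
    change _ = ((diff C₁).map (specOne t) ⊗ₖ 1 + 1 ⊗ₖ (diff C₂).map (specOne t) :
        Matrix (Fin C₁.n × Fin C₂.n) (Fin C₁.n × Fin C₂.n) (ZMod 2))
      (finProdFinEquiv.symm (finProdFinEquiv (i, j)))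
      (finProdFinEquiv.symm (finProdFinEquiv (k, l)))
    rw [Equiv.symm_apply_apply, Equiv.symm_apply_apply]
    simp [Matrix.one_apply, apply_ite (specOne t)]
  rw [hM]
  exact h

/-! ### The invariant `P` -/

theorem sum_map_eq_sum_range (f : ℤ → ℤ) (L : List ℤ) :
    (L.map f).sum = ∑ i ∈ Finset.range L.length, f (L.getD i 0) := by
  induction L with
  | nil => simp
  | cons a L ih =>
    rw [List.map_cons, List.sum_cons, ih, List.length_cons, Finset.sum_range_succ', add_comm]
    rfl

theorem sum_mul_phi (L : List ℤ) :
    ∑ j ∈ Finset.range ((L.map Int.natAbs).sum + 1), (j : ℤ) * phi j L =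
      ∑ i ∈ Finset.range L.length, if i % 2 = 0 then L.getD i 0 else 0 := by
  simp only [phi, Finset.mul_sum]
  rw [Finset.sum_comm]
  refine Finset.sum_congr rfl fun i _ => ?_
  by_cases hi : i % 2 = 0
  · simp only [if_pos hi]
    have hle := natAbs_getD_le L i
    generalize L.getD i 0 = b at hle
    rw [Finset.sum_eq_single b.natAbs]
    · split_ifs <;> omega
    · intro j _ hj
      rw [if_neg (by omega), if_neg (by omega)]
      simp
    · intro h
      exact absurd (Finset.mem_range.2 (by omega)) h
  · simp [hi]

theorem Pval_eq_gr {L : List ℤ} (hL : IsStdSeq L) :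
    Pval L = ((StdCx L).gr (stdEnd L 0)).1 := by
  change _ = (grRel L (stdEnd L 0 : ℕ)).1
  rw [stdEnd_val, Pval, sum_mul_phi, sum_map_eq_sum_range, Finset.mul_sum,
    ← Finset.sum_add_distrib, grRel]
  simp only [Fin.val_zero, if_true, Prod.fst_sum]
  refine Finset.sum_congr rfl fun i hi => ?_
  have hne := getD_ne_zero hL (Finset.mem_range.1 hi)
  generalize L.getD i 0 = b at hne
  unfold stepShift
  rcases lt_or_gt_of_ne hne with h | h
  · rw [Int.sign_eq_neg_one_of_neg h]
    split_ifs <;> simp only <;> omega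
  · rw [Int.sign_eq_one_of_pos h]
    split_ifs <;> simp only <;> omega

theorem even_Pval {L : List ℤ} (hL : IsStdSeq L) : Even (Pval L) := by
  have key : ∀ L : List ℤ, (∀ b ∈ L, b ≠ 0) → Even ((L.map Int.sign).sum + L.length) := by
    intro L
    induction L with
    | nil => simp
    | cons a L ih =>
      intro h
      obtain ⟨k, hk⟩ := ih fun b hb => h b (List.mem_cons_of_mem _ hb)
      have ha := h a List.mem_cons_self
      rw [List.map_cons, List.sum_cons, List.length_cons]
      push_cast
      rcases lt_or_gt_of_ne ha with h | h
      · rw [Int.sign_eq_neg_one_of_neg h]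
        exact ⟨k, by omega⟩
      · rw [Int.sign_eq_one_of_pos h]
        exact ⟨k + 1, by omega⟩
  obtain ⟨k, hk⟩ := key L hL.1
  obtain ⟨l, hl⟩ := hL.2
  refine Even.add (by simp) ⟨k - l, by omega⟩

theorem exists_Pval_eq (m : ℤ) : ∃ L : List ℤ, IsStdSeq L ∧ Pval L = 2 * m := by
  rcases lt_trichotomy m 0 with h | rfl | h
  · have hL : IsStdSeq [-m, -1] := ⟨by simp; omega, by simp⟩
    refine ⟨_, hL, ?_⟩
    rw [Pval_eq_gr hL]
    change (grRel _ 2).1 = _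
    simp only [grRel, Finset.sum_range_succ, Finset.sum_range_zero, stepShift, Prod.fst_add]
    simp [h.not_gt, abs_of_neg h]
  · exact ⟨[], ⟨by simp, by simp⟩, by simp [Pval, phi]⟩
  · have hL : IsStdSeq [-m, 1] := ⟨by simp; omega, by simp⟩
    refine ⟨_, hL, ?_⟩
    rw [Pval_eq_gr hL]
    change (grRel _ 2).1 = _
    simp only [grRel, Finset.sum_range_succ, Finset.sum_range_zero, stepShift, Prod.fst_add]
    simp [h]
    omega

theorem IsLocalMap.exists_gradedMat {C D : PreCx} {f : Msub C →ₗ[RUV] Msub D}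
    (hf : IsLocalMap C D f) : ∃ s, GradedMat C D (mat f) s :=
  hf.graded.imp fun _ => MapHomogShift.gradedMat

theorem Pval_eq_of_localEquiv {L L' : List ℤ} (hL : IsStdSeq L) (hL' : IsStdSeq L')
    (h : LocalEquiv (StdCx L) (StdCx L')) : Pval L = Pval L' := by
  obtain ⟨⟨f, hf⟩, g, hg⟩ := h
  obtain ⟨s, hs⟩ := hf.exists_gradedMat
  obtain ⟨t, ht⟩ := hg.exists_gradedMat
  rw [Pval_eq_gr hL, Pval_eq_gr hL']
  exact (gr_uTower_eq hL (mat_comm hg.chain) (mat_comm hf.chain) ht hs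
    (isTower_specOne_stdCx hL' 1) (isTower_specOne_stdCx hL' 0)
    ((hf.towers _ (isVTowerGen_stdCx hL)).spec_coeff_eq_one hL')
    ((hg.towers _ (isVTowerGen_stdCx hL')).spec_coeff_eq_one hL)).symm

theorem IsLocalMap.spec_mat_mul_eq_one {L : List ℤ} (hL : IsStdSeq L) {C : PreCx}
    {f : Msub C →ₗ[RUV] Msub (StdCx L)} {g : Msub (StdCx L) →ₗ[RUV] Msub C}
    (hf : IsLocalMap C (StdCx L) f) (hg : IsLocalMap (StdCx L) C g) :
    spec 1 ((mat g * mat f) (stdEnd L 1) (stdEnd L 1)) = 1 := by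
  rw [mat_mul_mat]
  exact (hf.towers _ (hg.towers _ (isVTowerGen_stdCx hL))).spec_coeff_eq_one hL

theorem map_spec_mulVec_col_eq_zero {L : List ℤ} (hL : IsStdSeq L) {C : PreCx}
    {A : Matrix (Fin C.n) (Fin (StdCx L).n) RUV} (hA : diff C * A = A * diff (StdCx L)) :
    (diff C).map (spec 1) *ᵥ (fun p => spec 1 (A p (stdEnd L 1))) = 0 := by
  obtain ⟨k, hk⟩ := isTower_stdCx hL 1
  have hcol := hk.col
  simp only [Matrix.map_apply] at hcol
  ext1 j
  have h1 := congrArg (spec 1) (congrFun (congrFun hA j) (stdEnd L 1))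
  simp only [Matrix.mul_apply, map_sum, map_mul] at h1
  simpa [hcol, Matrix.mulVec, dotProduct] using h1

theorem Pval_tensor {C₁ C₂ : PreCx} {L₁ L₂ L₃ : List ℤ} (hL₁ : IsStdSeq L₁) (hL₂ : IsStdSeq L₂)
    (hL₃ : IsStdSeq L₃) (h₁ : LocalEquiv C₁ (StdCx L₁)) (h₂ : LocalEquiv C₂ (StdCx L₂))
    (h₃ : LocalEquiv (tensorCx C₁ C₂) (StdCx L₃)) : Pval L₃ = Pval L₁ + Pval L₂ := by
  obtain ⟨⟨f₁, hf₁⟩, g₁, hg₁⟩ := h₁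
  obtain ⟨⟨f₂, hf₂⟩, g₂, hg₂⟩ := h₂
  obtain ⟨⟨f, hf⟩, g, hg⟩ := h₃
  obtain ⟨s₁, hs₁⟩ := hf₁.exists_gradedMat
  obtain ⟨s₂, hs₂⟩ := hf₂.exists_gradedMat
  obtain ⟨s, hs⟩ := hf.exists_gradedMat
  obtain ⟨t₁, ht₁⟩ := hg₁.exists_gradedMat
  obtain ⟨t₂, ht₂⟩ := hg₂.exists_gradedMat
  obtain ⟨t, ht⟩ := hg.exists_gradedMat
  have cF := tensorMat_comm (mat_comm hf₁.chain) (mat_comm hf₂.chain)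
  have cG := tensorMat_comm (mat_comm hg₁.chain) (mat_comm hg₂.chain)
  set F := tensorMat (mat f₁) (mat f₂) with hF
  set G := tensorMat (mat g₁) (mat g₂) with hG
  set e₀ := tensorIdx (StdCx L₁) (StdCx L₂) (stdEnd L₁ 1) (stdEnd L₂ 1) with he₀
  have tower := fun t => isTower_tensorCx (isTower_specOne_stdCx hL₁ t)
    (isTower_specOne_stdCx hL₂ t)
  have hGF : spec 1 ((G * F) e₀ e₀) = 1 := by
    rw [hG, hF, tensorMat_mul, he₀, tensorMat_tensorIdx, map_mul,
      hf₁.spec_mat_mul_eq_one hL₁ hg₁, hf₂.spec_mat_mul_eq_one hL₂ hg₂, one_mul]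
  obtain ⟨k₁, hk₁⟩ := isTower_stdCx hL₁ 1
  obtain ⟨k₂, hk₂⟩ := isTower_stdCx hL₂ 1
  have hrow : ∀ q, spec 1 (diff (tensorCx (StdCx L₁) (StdCx L₂)) e₀ q) = 0 := by
    intro q
    obtain ⟨i, j, rfl⟩ := exists_tensorIdx q
    have h1 := hk₁.row i
    have h2 := hk₂.row j
    simp only [Matrix.map_apply] at h1 h2
    rw [diff_tensorCx, Matrix.add_apply, he₀, tensorMat_tensorIdx, tensorMat_tensorIdx, map_add,
      map_mul, map_mul, h1, h2, zero_mul, mul_zero, add_zero]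
  have hcol : ∀ q, spec 1 (diff (tensorCx (StdCx L₁) (StdCx L₂)) q e₀) = 0 := by
    intro q
    obtain ⟨i, j, rfl⟩ := exists_tensorIdx q
    have h1 := hk₁.col i
    have h2 := hk₂.col j
    simp only [Matrix.map_apply] at h1 h2
    rw [diff_tensorCx, Matrix.add_apply, he₀, tensorMat_tensorIdx, tensorMat_tensorIdx, map_add,
      map_mul, map_mul, h1, h2, zero_mul, mul_zero, add_zero]
  set z : Msub (tensorCx C₁ C₂) := Finsupp.equivFunOnFinite.symm (G e₀) with hz
  have hzG : ∀ p, z p = G e₀ p := fun p => rfl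
  have hzcyc : dmap _ z ∈ uSub _ := by
    rw [mem_uSub_iff, specVec_dmap]
    ext1 q
    have h := congrArg (spec 1) (congrFun (congrFun cG e₀) q)
    simp only [Matrix.mul_apply, map_sum, map_mul, hrow, zero_mul, Finset.sum_const_zero] at h
    simpa [Matrix.vecMul, dotProduct, specVec, hzG] using h.symm
  obtain ⟨ρ, hρ⟩ := (hg.towers _ (isVTowerGen_stdCx hL₃)).exists_ratio hzcyc
  have hρF := hρ (fun p => spec 1 (F p e₀)) (by
    ext1 q
    have h := congrArg (spec 1) (congrFun (congrFun cF q) e₀)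
    simp only [Matrix.mul_apply, map_sum, map_mul, hcol, mul_zero, Finset.sum_const_zero] at h
    simpa [Matrix.mulVec, dotProduct] using h)
  have hρf := hρ _ (map_spec_mulVec_col_eq_zero hL₃ (mat_comm hf.chain))
  have e1 : specVec z ⬝ᵥ (fun p => spec 1 (F p e₀)) = 1 := by
    rw [← hGF, Matrix.mul_apply, map_sum]
    simp [dotProduct, specVec, hzG]
  have e2 : specVec (g (Finsupp.single (stdEnd L₃ 1) 1)) ⬝ᵥ (fun p => spec 1 (F p e₀)) =
      spec 1 ((mat g * F) (stdEnd L₃ 1) e₀) := by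
    rw [Matrix.mul_apply, map_sum]
    simp [dotProduct, specVec, mat]
  have e3 : specVec z ⬝ᵥ (fun p => spec 1 (mat f p (stdEnd L₃ 1))) =
      spec 1 ((G * mat f) e₀ (stdEnd L₃ 1)) := by
    rw [Matrix.mul_apply, map_sum]
    simp [dotProduct, specVec, hzG]
  have e4 : specVec (g (Finsupp.single (stdEnd L₃ 1) 1)) ⬝ᵥ
      (fun p => spec 1 (mat f p (stdEnd L₃ 1))) = 1 := by
    rw [← hf.spec_mat_mul_eq_one hL₃ hg, Matrix.mul_apply, map_sum]
    simp [dotProduct, specVec, mat]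
  rw [e1, e2] at hρF
  rw [e3, e4, mul_one, eq_one_of_mul_eq_one hρF.symm] at hρf
  rw [mul_comm] at hρF
  have h := gr_uTower_eq hL₃ (A := G * mat f) (B := mat g * F)
    (by rw [← Matrix.mul_assoc, cG, Matrix.mul_assoc, mat_comm hf.chain, Matrix.mul_assoc])
    (by rw [← Matrix.mul_assoc, mat_comm hg.chain, Matrix.mul_assoc, cF, Matrix.mul_assoc])
    ((ht₁.tensorMat ht₂).mul hs) (ht.mul (hs₁.tensorMat hs₂)) (tower 1) (tower 0)
    (eq_one_of_mul_eq_one hρF.symm) hρf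
  rw [Pval_eq_gr hL₁, Pval_eq_gr hL₂, Pval_eq_gr hL₃, ← h, gr_tensorIdx, Prod.fst_add]

end KnotLikeTowers

/-- The function `P : KL → 2ℤ`, defined on a knot-like complex with
standard representative `C(a_1, …, a_n)` by
`P(C) = -2 ∑_{j>0} j φ_j(C) + ∑_{i=1}^n sgn(a_i)`, is a surjective group homomorphism
from the local equivalence group `KL` onto `2ℤ`: it takes even values, is well defined
on local equivalence classes, is additive under `⊗_R`, and attains every even value. -/
theorem P_is_surjective_homomorphism :
    (∀ L : List ℤ, IsStdSeq L → Even (Pval L)) ∧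
    (∀ L L' : List ℤ, IsStdSeq L → IsStdSeq L' →
      LocalEquiv (StdCx L) (StdCx L') → Pval L = Pval L') ∧
    (∀ C₁ C₂ : PreCx, IsKnotLike C₁ → IsKnotLike C₂ →
      ∀ L₁ L₂ L₃ : List ℤ, IsStdSeq L₁ → IsStdSeq L₂ → IsStdSeq L₃ →
        LocalEquiv C₁ (StdCx L₁) → LocalEquiv C₂ (StdCx L₂) →
        LocalEquiv (tensorCx C₁ C₂) (StdCx L₃) →
        Pval L₃ = Pval L₁ + Pval L₂) ∧
    (∀ m : ℤ, ∃ L : List ℤ, IsStdSeq L ∧ Pval L = 2 * m) := by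
  refine ⟨fun L hL => even_Pval hL, fun L L' hL hL' h => Pval_eq_of_localEquiv hL hL' h, ?_,
    exists_Pval_eq⟩
  intro C₁ C₂ _ _ L₁ L₂ L₃ hL₁ hL₂ hL₃ h₁ h₂ h₃
  exact Pval_tensor hL₁ hL₂ hL₃ h₁ h₂ h₃
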